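/- Let T be a stable tree of the tree connection game and let P be a leaf-to-root path in T of length k. Then for every i with 1 < i < k − 2 such that the subtree rooted at u_{i-1}^P has more than 4 nodes (|T_{i-1}^P| > 4), the in-degrees strictly increase over two levels: d_{i-1}^P > d_{i+1}^P. -/

import Mathlib

open Function
open scoped ENNReal Classical

noncomputable section

namespace TCG

variable {n : ℕ}

/-- In-degree of node `v` in the network induced by profile `s` with root `r`:
the number of activated edges `(u, v)` with `u` an agent (a non-root node). -/
def indeg (r : Fin (n + 1)) (s : Fin (n + 1) → Fin (n + 1)) (v : Fin (n + 1)) : ℕ :=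
  Nat.card {u : Fin (n + 1) | u ≠ r ∧ s u = v}

/-- `|T(u)|`: the number of nodes having a directed path to `u` (including `u` itself). -/
def subtreeSize (s : Fin (n + 1) → Fin (n + 1)) (u : Fin (n + 1)) : ℕ :=
  Nat.card {w : Fin (n + 1) | ∃ k, s^[k] w = u}

/-- Cost of the agent at node `v` with respect to the root `r`:
the sum, over the edges `(u, u')` of the unique directed path from `v` to `r`,
of `indeg(u') / |T(u)|`; the cost is `∞` if no such path exists. -/
def cost (r : Fin (n + 1)) (s : Fin (n + 1) → Fin (n + 1)) (v : Fin (n + 1)) : ℝ≥0∞ :=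
  if h : ∃ k, s^[k] v = r then
    ∑ k ∈ Finset.range (Nat.find h),
      (indeg r s (s^[k + 1] v) : ℝ≥0∞) / (subtreeSize s (s^[k] v) : ℝ≥0∞)
  else ⊤

/-- A valid strategy profile: the root is absorbing (a formal convention encoding that the
root activates no edge), and every agent chooses a node different from herself. -/
def ValidProfile (r : Fin (n + 1)) (s : Fin (n + 1) → Fin (n + 1)) : Prop :=
  s r = r ∧ ∀ v, v ≠ r → s v ≠ v

/-- Pure Nash equilibrium (the induced network is *stable*): no agent can strictly
decrease her cost by unilaterally switching her activated edge to another node. -/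
def IsStable (r : Fin (n + 1)) (s : Fin (n + 1) → Fin (n + 1)) : Prop :=
  ValidProfile r s ∧
    ∀ v, v ≠ r → ∀ w, w ≠ v → cost r s v ≤ cost r (Function.update s v w) v

/-- Social cost: the sum of the costs of all agents (the non-root nodes). -/
def SC (s : Fin (n + 1) → Fin (n + 1)) : ℝ≥0∞ :=
  ∑ v ∈ Finset.univ.erase (0 : Fin (n + 1)), cost 0 s v

/-- Height of the induced network: the maximum length of a (leaf-to-)root path,
i.e. the least `k` such that every node arrives at the root after `k` steps. -/
def height (s : Fin (n + 1) → Fin (n + 1)) : ℕ :=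
  sInf {k | ∀ v, s^[k] v = 0}

/-- Fairness Ratio: maximum agent cost divided by minimum agent cost. -/
def FR (s : Fin (n + 1) → Fin (n + 1)) : ℝ≥0∞ :=
  (⨆ (v : Fin (n + 1)) (_ : v ≠ 0), cost 0 s v) /
    (⨅ (v : Fin (n + 1)) (_ : v ≠ 0), cost 0 s v)

lemma cost_root (r : Fin (n + 1)) (s : Fin (n + 1) → Fin (n + 1)) : cost r s r = 0 := by
  have h : ∃ k, s^[k] r = r := ⟨0, rfl⟩
  have h0 : Nat.find h = 0 := (Nat.find_eq_zero h).2 rfl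
  unfold cost
  rw [dif_pos h, h0, Finset.sum_range_zero]

lemma cost_eq_add_cost_parent (r : Fin (n + 1)) (s : Fin (n + 1) → Fin (n + 1))
    {v : Fin (n + 1)} (hv : v ≠ r) :
    cost r s v = (indeg r s (s v) : ℝ≥0∞) / (subtreeSize s v : ℝ≥0∞) + cost r s (s v) := by
  by_cases h : ∃ k, s^[k] (s v) = r
  · have h' : ∃ k, s^[k] v = r := by
      obtain ⟨k, hk⟩ := h
      exact ⟨k + 1, hk⟩
    have hf : Nat.find h' = Nat.find h + 1 := Nat.find_comp_succ h' h hv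
    unfold cost
    rw [dif_pos h', dif_pos h, hf, Finset.sum_range_succ', add_comm]
    rfl
  · have h' : ¬ ∃ k, s^[k] v = r := by
      rintro ⟨k, hk⟩
      cases k with
      | zero => exact hv hk
      | succ k => exact h ⟨k, hk⟩
    unfold cost
    rw [dif_neg h', dif_neg h, add_top]

lemma iterate_succ_ne_self {s : Fin (n + 1) → Fin (n + 1)} (hs : s 0 = 0)
    (htree : ∀ v, ∃ k, s^[k] v = 0) {x : Fin (n + 1)} (hx : x ≠ 0) (j : ℕ) :
    s^[j + 1] x ≠ x := by
  intro h
  obtain ⟨K, hK⟩ := htree x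
  have h1 : s^[(j + 1) * K] x = x := by
    rw [iterate_mul]
    exact iterate_fixed h K
  have h2 : s^[(j + 1) * K] x = 0 := by
    rw [show (j + 1) * K = j * K + K by ring, iterate_add_apply, hK]
    exact iterate_fixed hs _
  exact hx (h1.symm.trans h2)

lemma subtreeSize_pos (s : Fin (n + 1) → Fin (n + 1)) (u : Fin (n + 1)) :
    0 < subtreeSize s u :=
  Nat.card_pos_iff.2 ⟨⟨⟨u, 0, rfl⟩⟩, inferInstance⟩

lemma indeg_pos {r : Fin (n + 1)} {s : Fin (n + 1) → Fin (n + 1)} {u : Fin (n + 1)}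
    (hu : u ≠ r) : 0 < indeg r s (s u) :=
  Nat.card_pos_iff.2 ⟨⟨⟨u, hu, rfl⟩⟩, inferInstance⟩

lemma cost_ne_top {s : Fin (n + 1) → Fin (n + 1)} (htree : ∀ v, ∃ k, s^[k] v = 0)
    (v : Fin (n + 1)) : cost 0 s v ≠ ⊤ := by
  unfold cost
  rw [dif_pos (htree v)]
  refine ENNReal.sum_ne_top.2 fun k _ => ENNReal.div_ne_top (ENNReal.natCast_ne_top _) ?_
  exact_mod_cast (subtreeSize_pos s _).ne'

lemma subtreeSize_le_update_self (s : Fin (n + 1) → Fin (n + 1)) (v w : Fin (n + 1)) :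
    subtreeSize s v ≤ subtreeSize (Function.update s v w) v := by
  refine Nat.card_mono (Set.toFinite _) ?_
  rintro y ⟨k, hk⟩
  induction k generalizing y with
  | zero => exact ⟨0, hk⟩
  | succ k ih =>
    by_cases hy : y = v
    · exact ⟨0, hy⟩
    · obtain ⟨m, hm⟩ := ih hk
      exact ⟨m + 1, by rw [iterate_succ_apply, Function.update_of_ne hy, hm]⟩

lemma subtreeSize_le_update_of_reaches (s : Fin (n + 1) → Fin (n + 1)) {v w x : Fin (n + 1)}
    (hx : ∃ m, (Function.update s v w)^[m] w = x) :
    subtreeSize s x ≤ subtreeSize (Function.update s v w) x := by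
  refine Nat.card_mono (Set.toFinite _) ?_
  rintro y ⟨k, hk⟩
  induction k generalizing y with
  | zero => exact ⟨0, hk⟩
  | succ k ih =>
    by_cases hy : y = v
    · obtain ⟨m, hm⟩ := hx
      exact ⟨m + 1, by rw [iterate_succ_apply, hy, Function.update_self, hm]⟩
    · obtain ⟨m, hm⟩ := ih hk
      exact ⟨m + 1, by rw [iterate_succ_apply, Function.update_of_ne hy, hm]⟩

lemma indeg_update_le_of_ne (r : Fin (n + 1)) (s : Fin (n + 1) → Fin (n + 1))
    {v w x : Fin (n + 1)} (hx : x ≠ w) :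
    indeg r (Function.update s v w) x ≤ indeg r s x := by
  refine Nat.card_mono (Set.toFinite _) ?_
  rintro u ⟨hu, hux⟩
  have huv : u ≠ v := by
    rintro rfl
    rw [Function.update_self] at hux
    exact hx hux.symm
  rw [Function.update_of_ne huv] at hux
  exact ⟨hu, hux⟩

lemma indeg_update_le_succ (r : Fin (n + 1)) (s : Fin (n + 1) → Fin (n + 1))
    (v w x : Fin (n + 1)) :
    indeg r (Function.update s v w) x ≤ indeg r s x + 1 := by
  unfold indeg
  rw [Nat.card_coe_set_eq, Nat.card_coe_set_eq]
  refine le_trans (Set.ncard_le_ncard ?_ (Set.toFinite _)) (Set.ncard_insert_le v _)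
  rintro u ⟨hu, hux⟩
  by_cases huv : u = v
  · exact Or.inl huv
  · rw [Function.update_of_ne huv] at hux
    exact Or.inr ⟨hu, hux⟩

/-- Attaching `v` to one of its proper ancestors `w` does not increase the cost of any node
on the path from `w` to the root. -/
lemma cost_update_ancestor_le {s : Fin (n + 1) → Fin (n + 1)} (hs : s 0 = 0)
    (htree : ∀ v, ∃ k, s^[k] v = 0) {v w : Fin (n + 1)} (hv : v ≠ 0) {m : ℕ}
    (hw : s^[m + 1] v = w) (K : ℕ) (x : Fin (n + 1)) (hK : s^[K] x = 0)
    (j : ℕ) (hj : s^[j] w = x) (hupd : (Function.update s v w)^[j] w = x) :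
    cost 0 (Function.update s v w) x ≤ cost 0 s x := by
  induction K generalizing x j with
  | zero =>
    have hx : x = 0 := hK
    rw [hx, cost_root, cost_root]
  | succ K ih =>
    by_cases hx : x = 0
    · rw [hx, cost_root, cost_root]
    · have hxv : x ≠ v := by
        rintro rfl
        apply iterate_succ_ne_self hs htree hv (j + m)
        rw [show j + m + 1 = j + (m + 1) by ring, iterate_add_apply, hw, hj]
      have hup : Function.update s v w x = s x := Function.update_of_ne hxv w s
      have hw0 : w ≠ 0 := by
        rintro rfl
        exact hx (hj.symm.trans (iterate_fixed hs j))
      have hsx : s x ≠ w := by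
        intro h
        apply iterate_succ_ne_self hs htree hw0 j
        rw [iterate_succ_apply', hj, h]
      rw [cost_eq_add_cost_parent 0 s hx, cost_eq_add_cost_parent 0 _ hx, hup]
      refine add_le_add (ENNReal.div_le_div ?_ ?_) (ih (s x) hK (j + 1) ?_ ?_)
      · exact_mod_cast indeg_update_le_of_ne 0 s hsx
      · exact_mod_cast subtreeSize_le_update_of_reaches s ⟨j, hupd⟩
      · rw [iterate_succ_apply', hj]
      · rw [iterate_succ_apply', hupd, hup]

/-- In a stable tree, switching to a proper ancestor `w` is not profitable. -/
lemma cost_le_of_ancestor {s : Fin (n + 1) → Fin (n + 1)} (hstable : IsStable 0 s)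
    (htree : ∀ v, ∃ k, s^[k] v = 0) {v w : Fin (n + 1)} (hv : v ≠ 0) {m : ℕ}
    (hw : s^[m + 1] v = w) :
    cost 0 s v ≤ ((indeg 0 s w + 1 : ℕ) : ℝ≥0∞) / (subtreeSize s v : ℝ≥0∞) + cost 0 s w := by
  have hs := hstable.1.1
  have hwv : w ≠ v := hw ▸ iterate_succ_ne_self hs htree hv m
  refine (hstable.2 v hv w hwv).trans ?_
  rw [cost_eq_add_cost_parent 0 _ hv, Function.update_self]
  obtain ⟨K, hK⟩ := htree w
  refine add_le_add (ENNReal.div_le_div ?_ ?_)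
    (cost_update_ancestor_le hs htree hv hw K w hK 0 rfl rfl)
  · exact_mod_cast indeg_update_le_succ 0 s v w w
  · exact_mod_cast subtreeSize_le_update_self s v w

lemma natCast_div_eq_coe (a : ℕ) {b : ℕ} (hb : 0 < b) :
    (a : ℝ≥0∞) / (b : ℝ≥0∞) = (((a : NNReal) / (b : NNReal) : NNReal) : ℝ≥0∞) := by
  have : (b : NNReal) ≠ 0 := by exact_mod_cast hb.ne'
  rw [ENNReal.coe_div this, ENNReal.coe_natCast, ENNReal.coe_natCast]

lemma grandparent_ineq {s : Fin (n + 1) → Fin (n + 1)} (hstable : IsStable 0 s)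
    (htree : ∀ v, ∃ k, s^[k] v = 0) {v : Fin (n + 1)} (hv : v ≠ 0) (hp : s v ≠ 0) :
    indeg 0 s (s v) * subtreeSize s (s v) + indeg 0 s (s (s v)) * subtreeSize s v ≤
      (indeg 0 s (s (s v)) + 1) * subtreeSize s (s v) := by
  have h := cost_le_of_ancestor hstable htree hv (m := 1) (w := s (s v)) rfl
  have hTv := subtreeSize_pos s v
  have hTp := subtreeSize_pos s (s v)
  rw [cost_eq_add_cost_parent 0 s hv, cost_eq_add_cost_parent 0 s hp, ← add_assoc] at h
  replace h := (ENNReal.add_le_add_iff_right (cost_ne_top htree _)).1 h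
  rw [natCast_div_eq_coe _ hTv, natCast_div_eq_coe _ hTv, natCast_div_eq_coe _ hTp,
    ← ENNReal.coe_add, ENNReal.coe_le_coe, ← NNReal.coe_le_coe] at h
  push_cast at h
  have hTv' : (0 : ℝ) < subtreeSize s v := by exact_mod_cast hTv
  have hTp' : (0 : ℝ) < subtreeSize s (s v) := by exact_mod_cast hTp
  rw [div_add_div _ _ hTv'.ne' hTp'.ne', div_le_div_iff₀ (by positivity) hTv'] at h
  have h2 : ((indeg 0 s (s v) : ℝ) * subtreeSize s (s v) +
      indeg 0 s (s (s v)) * subtreeSize s v) ≤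
      (indeg 0 s (s (s v)) + 1) * subtreeSize s (s v) := by
    refine le_of_mul_le_mul_right ?_ hTv'
    linarith
  exact_mod_cast h2

lemma greatGrandparent_ineq {s : Fin (n + 1) → Fin (n + 1)} (hstable : IsStable 0 s)
    (htree : ∀ v, ∃ k, s^[k] v = 0) {v : Fin (n + 1)} (hv : v ≠ 0) (hp : s v ≠ 0)
    (hg : s (s v) ≠ 0) :
    indeg 0 s (s v) * subtreeSize s (s v) * subtreeSize s (s (s v)) +
      indeg 0 s (s (s v)) * subtreeSize s v * subtreeSize s (s (s v)) +
      indeg 0 s (s (s (s v))) * subtreeSize s v * subtreeSize s (s v) ≤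
      (indeg 0 s (s (s (s v))) + 1) * subtreeSize s (s v) * subtreeSize s (s (s v)) := by
  have h := cost_le_of_ancestor hstable htree hv (m := 2) (w := s (s (s v))) rfl
  have hTv := subtreeSize_pos s v
  have hTp := subtreeSize_pos s (s v)
  have hTg := subtreeSize_pos s (s (s v))
  rw [cost_eq_add_cost_parent 0 s hv, cost_eq_add_cost_parent 0 s hp,
    cost_eq_add_cost_parent 0 s hg, ← add_assoc, ← add_assoc] at h
  replace h := (ENNReal.add_le_add_iff_right (cost_ne_top htree _)).1 h
  rw [natCast_div_eq_coe _ hTv, natCast_div_eq_coe _ hTv, natCast_div_eq_coe _ hTp,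
    natCast_div_eq_coe _ hTg,
    ← ENNReal.coe_add, ← ENNReal.coe_add, ENNReal.coe_le_coe, ← NNReal.coe_le_coe] at h
  push_cast at h
  have hTv' : (0 : ℝ) < subtreeSize s v := by exact_mod_cast hTv
  have hTp' : (0 : ℝ) < subtreeSize s (s v) := by exact_mod_cast hTp
  have hTg' : (0 : ℝ) < subtreeSize s (s (s v)) := by exact_mod_cast hTg
  rw [div_add_div _ _ hTv'.ne' hTp'.ne', div_add_div _ _ (by positivity) hTg'.ne',
    div_le_div_iff₀ (by positivity) hTv'] at h
  have h2 : (indeg 0 s (s v) : ℝ) * subtreeSize s (s v) * subtreeSize s (s (s v)) +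
      indeg 0 s (s (s v)) * subtreeSize s v * subtreeSize s (s (s v)) +
      indeg 0 s (s (s (s v))) * subtreeSize s v * subtreeSize s (s v) ≤
      (indeg 0 s (s (s (s v))) + 1) * subtreeSize s (s v) * subtreeSize s (s (s v)) := by
    refine le_of_mul_le_mul_right ?_ hTv'
    linarith
  exact_mod_cast h2

/-- The agents connected directly to `p`, when the root is `0`. -/
def children (s : Fin (n + 1) → Fin (n + 1)) (p : Fin (n + 1)) : Finset (Fin (n + 1)) :=
  Finset.univ.filter fun u => u ≠ 0 ∧ s u = p

lemma mem_children {s : Fin (n + 1) → Fin (n + 1)} {p u : Fin (n + 1)} :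
    u ∈ children s p ↔ u ≠ 0 ∧ s u = p := by
  simp [children]

lemma card_children (s : Fin (n + 1) → Fin (n + 1)) (p : Fin (n + 1)) :
    (children s p).card = indeg 0 s p := by
  unfold indeg
  rw [Nat.card_coe_set_eq, ← Set.ncard_coe_finset]
  congr 1
  ext u
  simp [mem_children]

lemma subtreeSize_eq_card (s : Fin (n + 1) → Fin (n + 1)) (u : Fin (n + 1)) :
    subtreeSize s u = (Finset.univ.filter fun w => ∃ k, s^[k] w = u).card := by
  unfold subtreeSize
  rw [Nat.card_coe_set_eq, ← Set.ncard_coe_finset]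
  congr 1
  ext w
  simp

lemma subtreeSize_le_sum_children {s : Fin (n + 1) → Fin (n + 1)} (hs : s 0 = 0)
    {p : Fin (n + 1)} (hp : p ≠ 0) :
    subtreeSize s p ≤ ∑ c ∈ children s p, subtreeSize s c + 1 := by
  rw [subtreeSize_eq_card]
  simp_rw [subtreeSize_eq_card]
  refine le_trans (Finset.card_le_card (t := insert p ((children s p).biUnion
    fun c => Finset.univ.filter fun w => ∃ k, s^[k] w = c)) ?_)
    ((Finset.card_insert_le _ _).trans (Nat.succ_le_succ Finset.card_biUnion_le))
  intro y hy
  obtain ⟨k, hk⟩ := (Finset.mem_filter.1 hy).2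
  cases k with
  | zero => exact Finset.mem_insert.2 (Or.inl hk)
  | succ k =>
    refine Finset.mem_insert.2 (Or.inr (Finset.mem_biUnion.2
      ⟨s^[k] y, ?_, Finset.mem_filter.2 ⟨Finset.mem_univ _, k, rfl⟩⟩))
    rw [iterate_succ_apply'] at hk
    refine mem_children.2 ⟨fun h0 => hp ?_, hk⟩
    rw [← hk, h0, hs]

lemma indeg_add_two_le_subtreeSize {s : Fin (n + 1) → Fin (n + 1)} (hs : s 0 = 0)
    (htree : ∀ v, ∃ k, s^[k] v = 0) {a : Fin (n + 1)} (hp : s (s a) ≠ 0) :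
    indeg 0 s (s (s a)) + 2 ≤ subtreeSize s (s (s a)) := by
  have hsa : s (s (s a)) ≠ s (s a) := iterate_succ_ne_self hs htree hp 0
  have hc : s a ≠ 0 := fun h => hp (by rw [h, hs])
  have hca : s (s a) ≠ s a := iterate_succ_ne_self hs htree hc 0
  have ha : a ∉ children s (s (s a)) := fun h => hca (mem_children.1 h).2.symm
  have hpa : s (s a) ∉ insert a (children s (s (s a))) := by
    intro h
    rcases Finset.mem_insert.1 h with h | h
    · exact iterate_succ_ne_self hs htree (fun h0 => hc (by rw [h0, hs])) 1 h
    · exact hsa (mem_children.1 h).2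
  rw [← card_children, subtreeSize_eq_card, ← Nat.add_assoc _ 1 1,
    ← Finset.card_insert_of_notMem ha, ← Finset.card_insert_of_notMem hpa]
  refine Finset.card_le_card fun y hy => Finset.mem_filter.2 ⟨Finset.mem_univ _, ?_⟩
  rcases Finset.mem_insert.1 hy with rfl | hy
  · exact ⟨0, rfl⟩
  rcases Finset.mem_insert.1 hy with rfl | hy
  · exact ⟨2, rfl⟩
  · exact ⟨1, (mem_children.1 hy).2⟩

/-- In a stable tree, for a node `a` whose great-grandparent `s (s (s a))` is not the root,
the in-degree of the grandparent of `a` is smaller than that of its own grandparent. -/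
lemma indeg_lt_of_stable {s : Fin (n + 1) → Fin (n + 1)} (hstable : IsStable 0 s)
    (htree : ∀ v, ∃ k, s^[k] v = 0) {a : Fin (n + 1)} (hg : s (s (s a)) ≠ 0) :
    indeg 0 s (s (s a)) < indeg 0 s (s (s (s (s a)))) := by
  have hs := hstable.1.1
  by_contra! hle
  have hA2 := indeg_add_two_le_subtreeSize hs htree (a := a) (fun h => hg (by rw [h, hs]))
  generalize hc : s a = c at *
  generalize hp : s c = p at *
  generalize hgg : s p = g at *
  have hp0 : p ≠ 0 := fun h => hg (by rw [← hgg, h, hs])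
  have hc0 : c ≠ 0 := fun h => hp0 (by rw [← hp, h, hs])
  have h1 := grandparent_ineq hstable htree hc0 (hp ▸ hp0)
  have h2 := grandparent_ineq hstable htree hp0 (hgg ▸ hg)
  rw [hp, hgg] at h1
  rw [hgg] at h2
  have dp : 0 < indeg 0 s p := hp ▸ indeg_pos hc0
  have dg : 0 < indeg 0 s g := hgg ▸ indeg_pos hp0
  have dh : 0 < indeg 0 s (s g) := indeg_pos hg
  have hTc := subtreeSize_pos s c
  have hA := subtreeSize_pos s p
  have h32 : indeg 0 s p ≤ indeg 0 s g := by
    by_contra! hlt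
    nlinarith [Nat.mul_le_mul_right (subtreeSize s p) hlt, Nat.mul_pos dg hTc]
  have h21 : indeg 0 s g ≤ indeg 0 s (s g) := by
    by_contra! hlt
    nlinarith [Nat.mul_le_mul_right (subtreeSize s g) hlt, Nat.mul_pos dh hA]
  have eg : indeg 0 s g = indeg 0 s p := by omega
  have eh : indeg 0 s (s g) = indeg 0 s p := by omega
  have hx : ∀ x ∈ children s p, subtreeSize s x *
      (indeg 0 s p * (subtreeSize s p + subtreeSize s g)) ≤
      subtreeSize s p * subtreeSize s g := by
    intro x hx
    obtain ⟨hx0, hxp⟩ := mem_children.1 hx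
    have h := greatGrandparent_ineq hstable htree hx0 (hxp ▸ hp0) (by rwa [hxp, hgg])
    rw [hxp, hgg, eg, eh] at h
    nlinarith
  have hy : ∀ y ∈ (children s g).erase p, subtreeSize s y * indeg 0 s p ≤ subtreeSize s g := by
    intro y hy
    obtain ⟨hy0, hyg⟩ := mem_children.1 (Finset.mem_of_mem_erase hy)
    have h := grandparent_ineq hstable htree hy0 (hyg ▸ hg)
    rw [hyg, eg, eh] at h
    nlinarith
  have sx := Finset.sum_le_card_nsmul _ _ _ hx
  have sy := Finset.sum_le_card_nsmul _ _ _ hy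
  have hpg : p ∈ children s g := mem_children.2 ⟨hp0, hgg⟩
  rw [← Finset.sum_mul, card_children, smul_eq_mul] at sx
  rw [← Finset.sum_mul, Finset.card_erase_of_mem hpg, card_children, smul_eq_mul, eg] at sy
  have tp := subtreeSize_le_sum_children hs hp0
  have tg := subtreeSize_le_sum_children hs hg
  rw [← Finset.add_sum_erase _ _ hpg] at tg
  generalize ∑ x ∈ children s p, subtreeSize s x = X at *
  generalize ∑ x ∈ (children s g).erase p, subtreeSize s x = Y at *
  generalize indeg 0 s p = d at *
  generalize subtreeSize s p = A at *
  generalize subtreeSize s g = B at *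
  obtain ⟨e, rfl⟩ : ∃ e, d = e + 1 := ⟨d - 1, by omega⟩
  simp only [Nat.add_sub_cancel] at sy
  have sx' : X * (A + B) ≤ A * B := by
    refine Nat.le_of_mul_le_mul_left ?_ dp
    linarith
  have hAA : A * A ≤ A + B := by nlinarith [Nat.mul_le_mul_right (A + B) tp]
  have hB : B ≤ (e + 1) * (A + 1) := by nlinarith [Nat.mul_le_mul_right (e + 1) tg]
  nlinarith [Nat.mul_le_mul_right (A + 1) hA2]

/-- Along any leaf-to-root path `P = (z = u_k, …, u_0 = r)` of length `k`
in a stable tree, for every `1 < i < k − 2` such that the subtree rooted at `u_{i−1}`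
has more than `4` nodes, the in-degrees strictly increase over two levels:
`d_{i−1} > d_{i+1}`.  Here `u_j = s^[k−j] z`, `d_j = indeg(u_j)` and `T_j = T(u_j)`. -/
theorem degrees_strictly_increase {n : ℕ} (s : Fin (n + 1) → Fin (n + 1))
    (hstable : IsStable 0 s) (htree : ∀ v, ∃ k, s^[k] v = 0)
    (z : Fin (n + 1)) (k : ℕ)
    (hleaf : indeg 0 s z = 0)
    (hpath : s^[k] z = 0) (hminimal : ∀ j < k, s^[j] z ≠ 0) :
    ∀ i, 1 < i → i + 2 < k →
      4 < subtreeSize s (s^[k - (i - 1)] z) →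
      indeg 0 s (s^[k - (i + 1)] z) < indeg 0 s (s^[k - (i - 1)] z) := by
  intro i hi hik _
  obtain ⟨q, rfl⟩ : ∃ q, k = q + (i + 3) := ⟨k - (i + 3), by omega⟩
  have iter : ∀ j, s^[q + j] z = s^[j] (s^[q] z) := fun j => by
    rw [add_comm q j, iterate_add_apply]
  rw [show q + (i + 3) - (i + 1) = q + 2 by omega, show q + (i + 3) - (i - 1) = q + 4 by omega,
    iter, iter]
  refine indeg_lt_of_stable hstable htree ?_
  have := hminimal (q + 3) (by omega)
  rwa [iter] at this

end TCG
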